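/- Suppose r ∈ (-1,1], ν is a probability distribution on ℤ with ν(-2) > 0, and h_r^{(0)} is ν-harmonic on ℤ_{>0}. Then the random walk (X_i) oscillates — that is, P(X_i ≥ X_0 for all i ≥ 0) = 0 and P(X_i ≤ X_0 for all i ≥ 0) = 0 — if and only if h_r^{(1)} is ν-harmonic on ℤ_{>0}. -/

import Mathlib

open scoped BigOperators

noncomputable def h0 (r : ℝ) (l : ℤ) : ℝ :=
  if 0 ≤ l then
    (4 : ℝ) ^ (-l) *
      ∑ m ∈ Finset.range (l.toNat + 1),
        (Nat.choose (2 * m) m : ℝ) * (Nat.choose (2 * (l.toNat - m)) (l.toNat - m) : ℝ) *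
          (-r) ^ (l.toNat - m)
  else 0

noncomputable def h1 (r : ℝ) (l : ℤ) : ℝ :=
  if 1 ≤ l then ∑ p ∈ Finset.range l.toNat, h0 r (p : ℤ) else 0

noncomputable def h2 (r : ℝ) (l : ℤ) : ℝ :=
  if 2 ≤ l then ∑ p ∈ Finset.Icc 1 (l.toNat - 1), h1 r (p : ℤ) else 0

noncomputable def hm1 (r : ℝ) (l : ℤ) : ℝ := h0 r (l + 1) - h0 r l

noncomputable def hm2 (r : ℝ) (l : ℤ) : ℝ := hm1 r (l + 1) - hm1 r l

noncomputable def kernelR (r : ℝ) (k m : ℤ) : ℝ :=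
  ∑ p ∈ Finset.range m.toNat,
    h1 r (m - (p : ℤ)) * (hm2 r (k + (p : ℤ) - 1) + r * hm2 r (k + (p : ℤ) - 2))

/-- `ν` is a probability distribution on `ℤ`. -/
def IsProbDist (ν : ℤ → ℝ) : Prop := (∀ k, 0 ≤ ν k) ∧ HasSum ν 1

/-- A nonnegative function `f : ℤ → [0,∞)` is `ν`-harmonic on `ℤ_{>0}`. -/
def NuHarmonic (ν : ℤ → ℝ) (f : ℤ → ℝ) : Prop :=
  (∀ l, 0 ≤ f l) ∧ ∀ k : ℤ, 1 ≤ k → HasSum (fun l : ℤ => f (k + l) * ν l) (f k)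

noncomputable def Lnu (r : ℝ) (ν : ℤ → ℝ) : ℝ :=
  ∑' k : ℕ, ν ((k : ℤ) + 1) * h2 r ((k : ℤ) + 2)

noncomputable def phiNu (ν : ℤ → ℝ) (θ : ℝ) : ℂ :=
  ∑' k : ℤ, (ν k : ℂ) * Complex.exp (Complex.I * (k : ℂ) * (θ : ℂ))

open MeasureTheory ProbabilityTheory

section GeneratingFunction

open PowerSeries Filter Topology

/-- The generating series of `c ^ n * centralBinom n / 4 ^ n`, i.e. of `(1 - c X) ^ (-1/2)`. -/
noncomputable def invSqrtSeries (c : ℝ) : PowerSeries ℝ :=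
  PowerSeries.mk fun n => c ^ n * ((n.centralBinom : ℝ) / 4 ^ n)

theorem centralBinom_div_four_pow_succ (n : ℕ) :
    2 * ((n : ℝ) + 1) * (((n + 1).centralBinom : ℝ) / 4 ^ (n + 1)) =
      (2 * n + 1) * ((n.centralBinom : ℝ) / 4 ^ n) := by
  have h : ((n : ℝ) + 1) * (n + 1).centralBinom = 2 * (2 * n + 1) * n.centralBinom := by
    exact_mod_cast Nat.succ_mul_centralBinom_succ n
  rw [pow_succ]
  field_simp
  linarith

theorem invSqrtSeries_ode (c : ℝ) :
    2 * ((1 - C c * X) * d⁄dX ℝ (invSqrtSeries c)) = C c * invSqrtSeries c := by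
  ext n
  rw [two_mul, map_add, sub_mul, one_mul, mul_assoc, map_sub, coeff_C_mul, coeff_C_mul]
  cases n with
  | zero =>
    have := centralBinom_div_four_pow_succ 0
    simp [invSqrtSeries, coeff_derivative] at this ⊢
    linear_combination c * this
  | succ n =>
    have := centralBinom_div_four_pow_succ (n + 1)
    rw [coeff_succ_X_mul]
    simp only [invSqrtSeries, coeff_derivative, coeff_mk]
    push_cast at this ⊢
    linear_combination c ^ (n + 2) * this

theorem invSqrtSeries_sq (c : ℝ) : invSqrtSeries c ^ 2 * (1 - C c * X) = 1 := by
  apply derivative.ext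
  · have h := invSqrtSeries_ode c
    simp only [Derivation.leibniz, smul_eq_mul, map_sub, derivative_C, derivative_one,
      derivative_X, sq]
    linear_combination invSqrtSeries c * h
  · have : constantCoeff (invSqrtSeries c) = 1 := by
      rw [← coeff_zero_eq_constantCoeff_apply, invSqrtSeries, coeff_mk]
      simp
    simp [this]

theorem h0_natCast (r : ℝ) (n : ℕ) :
    h0 r n = coeff n (invSqrtSeries 1 * invSqrtSeries (-r)) := by
  rw [coeff_mul, Finset.Nat.sum_antidiagonal_eq_sum_range_succ
    (fun i j => coeff i (invSqrtSeries 1) * coeff j (invSqrtSeries (-r)))]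
  simp only [h0, Int.natCast_nonneg, if_true, Int.toNat_natCast, zpow_neg, zpow_natCast,
    Finset.mul_sum, invSqrtSeries, coeff_mk, one_pow, Nat.centralBinom_eq_two_mul_choose]
  refine Finset.sum_congr rfl fun m hm => ?_
  obtain ⟨k, rfl⟩ := Nat.exists_eq_add_of_le (Nat.lt_succ_iff.mp (Finset.mem_range.mp hm))
  rw [Nat.add_sub_cancel_left, pow_add]
  field_simp

theorem h0_zero (r : ℝ) : h0 r 0 = 1 := by simp [h0]

theorem h0_of_neg (r : ℝ) {l : ℤ} (hl : l < 0) : h0 r l = 0 := by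
  simp [h0, not_le.mpr hl]

theorem mk_h0_sq (r : ℝ) :
    (PowerSeries.mk fun n : ℕ => h0 r n) ^ 2 * (1 + C r * X) = PowerSeries.mk 1 := by
  have hH : (PowerSeries.mk fun n : ℕ => h0 r n) = invSqrtSeries 1 * invSqrtSeries (-r) := by
    ext n; rw [coeff_mk, h0_natCast]
  have h1 := invSqrtSeries_sq 1
  have h2 := invSqrtSeries_sq (-r)
  have h3 : (PowerSeries.mk 1 : PowerSeries ℝ) * (1 - X) = 1 := mk_one_mul_one_sub_eq_one ℝ
  simp only [map_one, one_mul, map_neg] at h1 h2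
  rw [hH]
  have h4 : (invSqrtSeries 1 * invSqrtSeries (-r)) ^ 2 * (1 + C r * X) = invSqrtSeries 1 ^ 2 := by
    linear_combination invSqrtSeries 1 ^ 2 * h2
  rw [h4]
  linear_combination (PowerSeries.mk 1 : PowerSeries ℝ) * h1 - invSqrtSeries 1 ^ 2 * h3

theorem summable_coeff_mk_sq {f : ℕ → ℝ} (hs : Summable f) (hpos : ∀ n, 0 ≤ f n) :
    Summable fun n => coeff n ((PowerSeries.mk f) ^ 2) := by
  refine (summable_sum_mul_antidiagonal_of_summable_mul
    (hs.mul_of_nonneg hs hpos hpos)).congr fun n => ?_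
  simp only [sq, coeff_mul, coeff_mk]

theorem not_summable_h0 (r : ℝ) (hpos : ∀ l, 0 ≤ h0 r l) :
    ¬ Summable fun n : ℕ => h0 r n := by
  intro hs
  set c : ℕ → ℝ := fun n => coeff n ((PowerSeries.mk fun n : ℕ => h0 r n) ^ 2) with hcdef
  have hc : Summable c := summable_coeff_mk_sq hs fun n => hpos n
  have hc0 : Tendsto c atTop (𝓝 0) := hc.tendsto_atTop_zero
  have hrec : ∀ n, c (n + 1) + r * c n = 1 := by
    intro n
    have h := congrArg (coeff (n + 1)) (mk_h0_sq r)
    rw [mul_add, mul_one, mul_left_comm, map_add, coeff_C_mul, coeff_succ_mul_X, coeff_mk] at h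
    exact h
  have hlim : Tendsto (fun n => c (n + 1) + r * c n) atTop (𝓝 (0 + r * 0)) :=
    (hc0.comp (tendsto_add_atTop_nat 1)).add (hc0.const_mul r)
  simp only [hrec] at hlim
  have := tendsto_nhds_unique hlim tendsto_const_nhds
  norm_num at this

theorem tendsto_centralBinom_div_four_pow :
    Tendsto (fun n : ℕ => (n.centralBinom : ℝ) / 4 ^ n) atTop (𝓝 0) := by
  have hb : ∀ n : ℕ, (n + 1) * ((n.centralBinom : ℝ) / 4 ^ n) ^ 2 ≤ 1 := by
    intro n
    induction n with
    | zero => simp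
    | succ n ih =>
      have h := centralBinom_div_four_pow_succ n
      set a := (n.centralBinom : ℝ) / 4 ^ n
      set b := ((n + 1).centralBinom : ℝ) / 4 ^ (n + 1)
      have hn : (0 : ℝ) ≤ n := n.cast_nonneg
      have hb : b = (2 * n + 1) / (2 * (n + 1)) * a := by
        field_simp; linarith
      rw [hb]
      push_cast
      have : ((n : ℝ) + 1 + 1) * ((2 * n + 1) / (2 * (n + 1)) * a) ^ 2 =
          ((n + 2) * (2 * n + 1) ^ 2) / (4 * (n + 1) ^ 3) * ((n + 1) * a ^ 2) := by
        field_simp; ring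
      rw [this]
      refine mul_le_one₀ ?_ (by positivity) ih
      rw [div_le_one (by positivity)]
      nlinarith
  have hsq : Tendsto (fun n : ℕ => ((n.centralBinom : ℝ) / 4 ^ n) ^ 2) atTop (𝓝 0) := by
    refine squeeze_zero (fun n => sq_nonneg _) (fun n => ?_)
      (tendsto_one_div_add_atTop_nhds_zero_nat (𝕜 := ℝ))
    rw [le_div_iff₀ (by positivity), mul_comm]
    exact hb n
  have h := hsq.sqrt
  rw [Real.sqrt_zero] at h
  exact h.congr fun n => Real.sqrt_sq (by positivity)

theorem tendsto_h0_of_abs_lt_one {r : ℝ} (hr : |r| < 1) :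
    Tendsto (fun n : ℕ => h0 r n) atTop (𝓝 0) := by
  have ha1 : ∀ n : ℕ, (n.centralBinom : ℝ) / 4 ^ n ≤ 1 := fun n => by
    rw [div_le_one (by positivity)]
    exact_mod_cast Nat.centralBinom_le_four_pow n
  have ha0 : ∀ n : ℕ, 0 ≤ (n.centralBinom : ℝ) / 4 ^ n := fun n => by positivity
  set a : ℕ → ℝ := fun n => (n.centralBinom : ℝ) / 4 ^ n with ha
  have hsum : ∀ n : ℕ, h0 r n = ∑' j : ℕ, if j ≤ n then a (n - j) * ((-r) ^ j * a j) else 0 := by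
    intro n
    rw [tsum_eq_sum (s := Finset.range (n + 1)), h0_natCast, mul_comm, coeff_mul,
      Finset.Nat.sum_antidiagonal_eq_sum_range_succ
        (fun i j => coeff i (invSqrtSeries (-r)) * coeff j (invSqrtSeries 1))]
    · refine Finset.sum_congr rfl fun j hj => ?_
      rw [if_pos (Nat.lt_succ_iff.mp (Finset.mem_range.mp hj))]
      simp [invSqrtSeries, ha, mul_comm]
    · intro j hj
      rw [if_neg]
      simpa using hj
  simp_rw [hsum]
  have := tendsto_tsum_of_dominated_convergence (𝓕 := atTop) (bound := fun j : ℕ => |r| ^ j)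
    (f := fun (n j : ℕ) => if j ≤ n then a (n - j) * ((-r) ^ j * a j) else 0)
    (g := fun _ => (0 : ℝ)) (summable_geometric_of_lt_one (abs_nonneg r) hr) ?_ ?_
  · simpa using this
  · intro j
    have h1 : Tendsto (fun n => a (n - j) * ((-r) ^ j * a j)) atTop (𝓝 (0 * ((-r) ^ j * a j))) :=
      (tendsto_centralBinom_div_four_pow.comp (tendsto_sub_atTop_nat j)).mul_const _
    rw [zero_mul] at h1
    refine h1.congr' ?_
    filter_upwards [eventually_ge_atTop j] with n hn
    rw [if_pos hn]
  · refine Eventually.of_forall fun n j => ?_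
    split_ifs
    · rw [Real.norm_eq_abs, abs_mul, abs_mul, abs_pow, abs_neg, abs_of_nonneg (ha0 _),
        abs_of_nonneg (ha0 _)]
      have h3 : 0 ≤ |r| ^ j := by positivity
      exact (mul_le_of_le_one_left (mul_nonneg h3 (ha0 _)) (ha1 _)).trans
        (mul_le_of_le_one_right h3 (ha1 _))
    · simp

theorem h0_one_rec (n : ℕ) : ((n : ℝ) + 2) * h0 1 ((n + 2 : ℕ) : ℤ) = (n + 1) * h0 1 (n : ℤ) := by
  have h1 := invSqrtSeries_ode 1
  have h2 := invSqrtSeries_ode (-1)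
  simp only [map_one, one_mul, map_neg, neg_mul, sub_neg_eq_add] at h1 h2
  have h : d⁄dX ℝ (invSqrtSeries 1 * invSqrtSeries (-1)) -
      X * (X * d⁄dX ℝ (invSqrtSeries 1 * invSqrtSeries (-1))) =
      X * (invSqrtSeries 1 * invSqrtSeries (-1)) := by
    have h2' : (2 : PowerSeries ℝ) ≠ 0 := fun h => by
      have h3 := congrArg constantCoeff h
      rw [map_ofNat, map_zero] at h3
      norm_num at h3
    apply mul_left_cancel₀ h2'
    simp only [Derivation.leibniz, smul_eq_mul]
    linear_combination (1 + X) * invSqrtSeries (-1) * h1 + (1 - X) * invSqrtSeries 1 * h2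
  rw [h0_natCast, h0_natCast]
  have hc := congrArg (coeff (n + 1)) h
  rw [map_sub, coeff_succ_X_mul, coeff_succ_X_mul, coeff_derivative] at hc
  cases n with
  | zero => simp at hc ⊢; linarith
  | succ n =>
    rw [coeff_succ_X_mul, coeff_derivative] at hc
    push_cast at hc ⊢
    linarith

theorem tendsto_h0_one : Tendsto (fun n : ℕ => h0 1 n) atTop (𝓝 0) := by
  have hodd : ∀ n : ℕ, h0 1 ((2 * n + 1 : ℕ) : ℤ) = 0 := by
    intro n
    induction n with
    | zero => simp [h0, Finset.sum_range_succ]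
    | succ n ih =>
      have h := h0_one_rec (2 * n + 1)
      rw [ih, mul_zero] at h
      exact (mul_eq_zero.mp h).resolve_left (by positivity)
  have heven : ∀ n : ℕ, h0 1 ((2 * n : ℕ) : ℤ) = (n.centralBinom : ℝ) / 4 ^ n := by
    intro n
    induction n with
    | zero => simp [h0]
    | succ n ih =>
      have h := h0_one_rec (2 * n)
      have h' := centralBinom_div_four_pow_succ n
      rw [ih] at h
      have hn : (2 * (n : ℝ) + 2) ≠ 0 := by positivity
      apply mul_left_cancel₀ hn
      push_cast at h
      rw [show 2 * (n + 1) = 2 * n + 2 by ring]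
      push_cast
      linarith
  have hb : ∀ n : ℕ, |h0 1 n| ≤ ((n / 2).centralBinom : ℝ) / 4 ^ (n / 2) := by
    intro n
    rcases Nat.even_or_odd' n with ⟨m, rfl | rfl⟩
    · rw [heven, abs_of_nonneg (by positivity), Nat.mul_div_cancel_left m two_pos]
    · rw [hodd, abs_zero]; positivity
  exact squeeze_zero_norm hb
    (tendsto_centralBinom_div_four_pow.comp (Nat.tendsto_div_const_atTop two_ne_zero))

theorem tendsto_h0 {r : ℝ} (hr : r ∈ Set.Ioc (-1 : ℝ) 1) : Tendsto (h0 r) atTop (𝓝 0) := by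
  have h : Tendsto (fun n : ℕ => h0 r n) atTop (𝓝 0) := by
    rcases hr.2.eq_or_lt with rfl | h
    · exact tendsto_h0_one
    · exact tendsto_h0_of_abs_lt_one (abs_lt.mpr ⟨hr.1, h⟩)
  have htn : Tendsto Int.toNat atTop atTop :=
    tendsto_atTop.mpr fun b => by
      filter_upwards [eventually_ge_atTop (b : ℤ)] with l hl
      omega
  refine (h.comp htn).congr' ?_
  filter_upwards [eventually_ge_atTop (0 : ℤ)] with l hl
  simp [Int.toNat_of_nonneg hl]

theorem h1_add_one (r : ℝ) (k : ℤ) : h1 r (k + 1) = h1 r k + h0 r k := by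
  rcases lt_or_ge k 0 with hk | hk
  · rw [h0_of_neg r hk, h1, h1, if_neg (by omega), if_neg (by omega), add_zero]
  · lift k to ℕ using hk
    rw [h1, if_pos (by omega), show ((k : ℤ) + 1).toNat = k + 1 by omega, Finset.sum_range_succ, h1]
    rcases k.eq_zero_or_pos with rfl | hk
    · simp
    · rw [if_pos (by omega), Int.toNat_natCast]

end GeneratingFunction

section KilledWalk

open Filter Topology
open scoped ENNReal

theorem tsum_ofReal_eq_iff_hasSum {ι : Type*} {f : ι → ℝ} {a : ℝ} (hf : ∀ i, 0 ≤ f i)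
    (ha : 0 ≤ a) : ∑' i, ENNReal.ofReal (f i) = ENNReal.ofReal a ↔ HasSum f a := by
  constructor
  · intro h
    have := ENNReal.hasSum_toReal (f := fun i => ENNReal.ofReal (f i)) (by simp [h])
    rw [← ENNReal.tsum_toReal_eq fun i => ENNReal.ofReal_ne_top, h,
      ENNReal.toReal_ofReal ha] at this
    exact this.congr_fun fun i => (ENNReal.toReal_ofReal (hf i)).symm
  · intro h
    rw [← h.tsum_eq, ENNReal.ofReal_tsum_of_nonneg hf h.summable]

/-- Maximum principle: a function that is harmonic on `ℤ_{>0}`, nonpositive on `ℤ_{≤0}` and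
vanishing at `+∞` is nonpositive. -/
theorem nonpos_of_harmonic {ν : ℤ → ℝ} (hprob : IsProbDist ν) (hν2 : 0 < ν (-2)) {e : ℤ → ℝ}
    (hneg : ∀ k ≤ 0, e k ≤ 0) (hharm : ∀ k, 1 ≤ k → HasSum (fun l => e (k + l) * ν l) (e k))
    (hlim : Tendsto e atTop (𝓝 0)) (k : ℤ) : e k ≤ 0 := by
  by_contra! hk
  obtain ⟨N, hN⟩ := eventually_atTop.mp (hlim.eventually_lt_const hk)
  have hkpos : 1 ≤ k := by
    by_contra! h
    exact absurd (hneg k (by omega)) (not_le.mpr hk)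
  have hkN : k < N := by
    by_contra! h
    exact lt_irrefl _ (hN k h)
  obtain ⟨m, -, hm⟩ := Finset.exists_max_image (Finset.Icc 1 N) e
    ⟨k, Finset.mem_Icc.mpr ⟨hkpos, hkN.le⟩⟩
  have hkm : e k ≤ e m := hm k (Finset.mem_Icc.mpr ⟨hkpos, hkN.le⟩)
  have hmax : ∀ j, e j ≤ e m := by
    intro j
    rcases le_or_gt j 0 with hj | hj
    · exact (hneg j hj).trans (hk.le.trans hkm)
    rcases le_or_gt j N with hjN | hjN
    · exact hm j (Finset.mem_Icc.mpr ⟨hj, hjN⟩)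
    · exact (hN j hjN.le).le.trans hkm
  have hprop : ∀ n : ℕ, e (m - 2 * n) = e m := by
    intro n
    induction n with
    | zero => simp
    | succ n ih =>
      have hpos : 1 ≤ m - 2 * (n : ℤ) := by
        by_contra! h
        have := hneg _ (show m - 2 * (n : ℤ) ≤ 0 by omega)
        linarith
      have hs := (hprob.2.mul_left (e m)).sub (hharm _ hpos)
      rw [mul_one, ih, sub_self] at hs
      have hz := (hasSum_zero_iff_of_nonneg fun l => by
        rw [← sub_mul]
        exact mul_nonneg (sub_nonneg.mpr (hmax _)) (hprob.1 l)).mp hs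
      have h2 := congrFun hz (-2)
      rw [Pi.zero_apply, ← sub_mul, mul_eq_zero, or_iff_left hν2.ne', sub_eq_zero] at h2
      rw [h2]
      congr 1
      push_cast
      ring
  have h1 := hprop m.toNat
  have h2 := hneg (m - 2 * (m.toNat : ℤ)) (by omega)
  linarith

/-- One step of the walk with step weights `p`, killed when it enters the complement of `A`. -/
noncomputable def killedStep (p : ℤ → ℝ≥0∞) (A : Set ℤ) (f : ℤ → ℝ≥0∞) (s : ℤ) : ℝ≥0∞ :=
  ∑' l, p l * A.indicator f (s + l)

/-- The adjoint of one step of the walk killed on entering `ℤ_{≥0}`, in the variable `k = -s`. -/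
noncomputable def dualStep (p : ℤ → ℝ≥0∞) (f : ℤ → ℝ≥0∞) (k : ℤ) : ℝ≥0∞ :=
  if 1 ≤ k then ∑' i, f i * p (i - k) else 0

/-- The weight of paths from `0` to `-k` of length `n` that stay negative after time `0`. -/
noncomputable def killedMass (p : ℤ → ℝ≥0∞) (n : ℕ) : ℤ → ℝ≥0∞ :=
  (dualStep p)^[n] (Pi.single 0 1)

theorem killedMass_succ (p : ℤ → ℝ≥0∞) (n : ℕ) :
    killedMass p (n + 1) = dualStep p (killedMass p n) :=
  Function.iterate_succ_apply' _ _ _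

theorem iterate_killedStep_zero (p : ℤ → ℝ≥0∞) (n : ℕ) (f : ℤ → ℝ≥0∞) :
    (killedStep p (Set.Iio 0))^[n] f 0 = ∑' j, killedMass p n j * f (-j) := by
  induction n generalizing f with
  | zero =>
    rw [tsum_eq_single 0 (fun j hj => by simp [killedMass, hj])]
    simp [killedMass]
  | succ n ih =>
    rw [Function.iterate_succ_apply, ih, killedMass_succ]
    calc ∑' j, killedMass p n j * killedStep p (Set.Iio 0) f (-j)
        = ∑' j, ∑' i, killedMass p n j * (p (j - i) * (Set.Iio 0).indicator f (-i)) := by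
          refine tsum_congr fun j => ?_
          rw [killedStep, ← (Equiv.subLeft j).tsum_eq, ENNReal.tsum_mul_left]
          simp [sub_eq_add_neg]
      _ = ∑' i, ∑' j, killedMass p n j * (p (j - i) * (Set.Iio 0).indicator f (-i)) :=
          ENNReal.tsum_comm
      _ = ∑' i, dualStep p (killedMass p n) i * f (-i) := by
          refine tsum_congr fun i => ?_
          simp_rw [← mul_assoc]
          rw [ENNReal.tsum_mul_right, dualStep]
          by_cases hi : 1 ≤ i
          · rw [if_pos hi, Set.indicator_of_mem (by simp; omega)]
          · rw [if_neg hi, Set.indicator_of_notMem (by simp; omega), mul_zero, zero_mul]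

theorem dualStep_add (p f g : ℤ → ℝ≥0∞) : dualStep p (f + g) = dualStep p f + dualStep p g := by
  ext k
  by_cases hk : 1 ≤ k
  · simp [dualStep, hk, add_mul, ENNReal.tsum_add]
  · simp [dualStep, hk]

theorem dualStep_tsum (p : ℤ → ℝ≥0∞) (f : ℕ → ℤ → ℝ≥0∞) :
    dualStep p (fun k => ∑' n, f n k) = fun k => ∑' n, dualStep p (f n) k := by
  ext k
  by_cases hk : 1 ≤ k
  · simp only [dualStep, hk, if_true, ← ENNReal.tsum_mul_right]
    exact ENNReal.tsum_comm
  · simp [dualStep, hk]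

theorem tsum_killedMass (p : ℤ → ℝ≥0∞) (k : ℤ) :
    ∑' n, killedMass p n k =
      (Pi.single 0 1 : ℤ → ℝ≥0∞) k + dualStep p (fun j => ∑' n, killedMass p n j) k := by
  rw [dualStep_tsum, tsum_eq_zero_add' ENNReal.summable]
  simp_rw [killedMass_succ]
  rfl

theorem tsum_killedMass_le {p H : ℤ → ℝ≥0∞} (hH : H = Pi.single 0 1 + dualStep p H) (k : ℤ) :
    ∑' n, killedMass p n k ≤ H k := by
  have hsum : ∀ N, H = ∑ n ∈ Finset.range N, killedMass p n + (dualStep p)^[N] H := by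
    intro N
    induction N with
    | zero => simp
    | succ N ih =>
      have hadd : ∀ (n : ℕ) (f g : ℤ → ℝ≥0∞),
          (dualStep p)^[n] (f + g) = (dualStep p)^[n] f + (dualStep p)^[n] g := by
        intro n
        induction n with
        | zero => intro f g; rfl
        | succ n ihn => intro f g; simp only [Function.iterate_succ_apply, dualStep_add, ihn]
      rw [Finset.sum_range_succ, add_assoc, Function.iterate_succ_apply, killedMass, ← hadd, ← hH]
      exact ih
  refine ENNReal.summable.tsum_le_of_sum_range_le fun N => ?_
  conv_rhs => rw [hsum N]
  rw [Pi.add_apply, Finset.sum_apply]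
  exact le_self_add

variable {ν : ℤ → ℝ} {r : ℝ}

theorem ofReal_h0_eq (hprob : IsProbDist ν) (hharm : NuHarmonic ν (h0 r)) :
    (fun k => ENNReal.ofReal (h0 r k)) = Pi.single 0 1 +
      dualStep (fun l => ENNReal.ofReal (ν l)) (fun k => ENNReal.ofReal (h0 r k)) := by
  ext k
  rw [Pi.add_apply, dualStep]
  rcases lt_trichotomy k 0 with hk | rfl | hk
  · rw [if_neg (by omega), Pi.single_eq_of_ne hk.ne, h0_of_neg r hk]; simp
  · simp [h0_zero]
  · rw [if_pos (by omega), Pi.single_eq_of_ne hk.ne', zero_add,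
      ← (tsum_ofReal_eq_iff_hasSum (fun l => mul_nonneg (hharm.1 _) (hprob.1 l))
        (hharm.1 k)).mpr (hharm.2 k hk)]
    refine Eq.trans ?_ ((Equiv.addLeft k).tsum_eq _)
    refine tsum_congr fun l => ?_
    rw [ENNReal.ofReal_mul (hharm.1 _)]
    simp

theorem tsum_killedMass_eq_h0 (hr : r ∈ Set.Ioc (-1 : ℝ) 1) (hprob : IsProbDist ν)
    (hν2 : 0 < ν (-2)) (hharm : NuHarmonic ν (h0 r)) (k : ℤ) :
    ∑' n, killedMass (fun l => ENNReal.ofReal (ν l)) n k = ENNReal.ofReal (h0 r k) := by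
  set p : ℤ → ℝ≥0∞ := fun l => ENNReal.ofReal (ν l) with hp
  set G : ℤ → ℝ≥0∞ := fun k => ∑' n, killedMass p n k with hG
  have hle : ∀ k, G k ≤ ENNReal.ofReal (h0 r k) :=
    tsum_killedMass_le (ofReal_h0_eq hprob hharm)
  have hfin : ∀ k, G k ≠ ∞ := fun k => ne_top_of_le_ne_top ENNReal.ofReal_ne_top (hle k)
  have hGr : ∀ k, (G k).toReal ≤ h0 r k := fun k =>
    ENNReal.toReal_le_of_le_ofReal (hharm.1 k) (hle k)
  have hGharm : ∀ k, 1 ≤ k → HasSum (fun l => (G (k + l)).toReal * ν l) (G k).toReal := by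
    intro k hk
    rw [← tsum_ofReal_eq_iff_hasSum (fun l => mul_nonneg ENNReal.toReal_nonneg (hprob.1 l))
      ENNReal.toReal_nonneg, ENNReal.ofReal_toReal (hfin k)]
    change _ = ∑' n, killedMass p n k
    rw [tsum_killedMass, Pi.single_eq_of_ne (by omega), zero_add, dualStep, if_pos hk]
    refine Eq.trans ?_ ((Equiv.addLeft k).tsum_eq _)
    refine tsum_congr fun l => ?_
    rw [ENNReal.ofReal_mul ENNReal.toReal_nonneg, ENNReal.ofReal_toReal (hfin _)]
    simp [hp, hG]
  refine le_antisymm (hle k) (ENNReal.ofReal_le_of_le_toReal (sub_nonpos.mp ?_))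
  refine nonpos_of_harmonic (e := fun k => h0 r k - (G k).toReal) hprob hν2 ?_ ?_ ?_ k
  · intro j hj
    rw [hG]
    simp only
    rw [tsum_killedMass, dualStep, if_neg (by omega)]
    rcases hj.lt_or_eq with h | rfl
    · simp [h0_of_neg r h]
    · simp [h0_zero]
  · intro j hj
    simpa only [sub_mul] using (hharm.2 j hj).sub (hGharm j hj)
  · refine squeeze_zero (fun j => sub_nonneg.mpr (hGr j)) (fun j => ?_) (tendsto_h0 hr)
    simp

theorem tsum_ite_ofReal_h0 (hpos : ∀ l, 0 ≤ h0 r l) (l : ℤ) :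
    (∑' j, if j ≤ l then ENNReal.ofReal (h0 r j) else 0) = ENNReal.ofReal (h1 r (1 + l)) := by
  rcases lt_or_ge l 0 with hl | hl
  · rw [h1, if_neg (by omega), ENNReal.ofReal_zero, ENNReal.tsum_eq_zero]
    intro j
    split_ifs with h
    · rw [h0_of_neg r (by omega), ENNReal.ofReal_zero]
    · rfl
  · lift l to ℕ using hl
    rw [tsum_eq_sum (s := (Finset.range (l + 1)).map Nat.castEmbedding), Finset.sum_map, h1,
      if_pos (by omega), ENNReal.ofReal_sum_of_nonneg (f := fun p : ℕ => h0 r p) (fun p _ => hpos p),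
      show (1 + (l : ℤ)).toNat = l + 1 by omega]
    · refine Finset.sum_congr rfl fun j hj => ?_
      rw [Finset.mem_range] at hj
      rw [Nat.castEmbedding_apply, if_pos (by omega)]
    · intro j hj
      split_ifs with h
      · rw [h0_of_neg, ENNReal.ofReal_zero]
        by_contra! hj0
        lift j to ℕ using hj0
        exact hj (Finset.mem_map_of_mem _ (Finset.mem_range.mpr (by omega)))
      · rfl

theorem tsum_killedMass_succ_add {p : ℤ → ℝ≥0∞} (hp : ∑' l, p l = 1) (n : ℕ) :
    ∑' j, killedMass p (n + 1) j +
      ∑' j, killedMass p n j * (∑' l, if j ≤ l then p l else 0) = ∑' j, killedMass p n j := by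
  have h := iterate_killedStep_zero p (n + 1) 1
  rw [Function.iterate_succ_apply, iterate_killedStep_zero] at h
  simp only [Pi.one_apply, mul_one] at h
  rw [← h, ← ENNReal.tsum_add]
  refine tsum_congr fun j => ?_
  rw [← mul_add, killedStep, ← ENNReal.tsum_add]
  conv_rhs => rw [← mul_one (killedMass p n j), ← hp]
  congr 1
  refine tsum_congr fun l => ?_
  by_cases hl : j ≤ l
  · rw [if_pos hl, Set.indicator_of_notMem (by simp; omega), mul_zero, zero_add]
  · rw [if_neg hl, Set.indicator_of_mem (by simp; omega), Pi.one_apply, mul_one, add_zero]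

/-- The one-step defect of `h1` at `1` is the probability that the walk stays negative. -/
theorem limit_add_tsum_h1 (hr : r ∈ Set.Ioc (-1 : ℝ) 1) (hprob : IsProbDist ν)
    (hν2 : 0 < ν (-2)) (hharm : NuHarmonic ν (h0 r)) {x : ℝ≥0∞}
    (hx : Tendsto (fun n => (killedStep (fun l => ENNReal.ofReal (ν l)) (Set.Iio 0))^[n] 1 0)
      atTop (𝓝 x)) :
    x + ∑' l, ENNReal.ofReal (h1 r (1 + l) * ν l) = 1 := by
  set p : ℤ → ℝ≥0∞ := fun l => ENNReal.ofReal (ν l) with hp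
  have hp1 : ∑' l, p l = 1 := by
    rw [(tsum_ofReal_eq_iff_hasSum hprob.1 zero_le_one).mpr hprob.2, ENNReal.ofReal_one]
  set t : ℤ → ℝ≥0∞ := fun j => ∑' l, if j ≤ l then p l else 0 with ht
  have htel : ∀ N, ∑' j, killedMass p N j +
      ∑ n ∈ Finset.range N, ∑' j, killedMass p n j * t j = 1 := by
    intro N
    induction N with
    | zero =>
      rw [tsum_eq_single 0 (fun j hj => by simp [killedMass, hj])]
      simp [killedMass]
    | succ N ih =>
      rw [Finset.sum_range_succ, add_comm (∑ n ∈ _, _), ← add_assoc, tsum_killedMass_succ_add hp1, ih]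
  have hlim := hx.add (ENNReal.tendsto_nat_tsum fun n => ∑' j, killedMass p n j * t j)
  simp only [iterate_killedStep_zero, Pi.one_apply, mul_one, htel] at hlim
  rw [tendsto_nhds_unique tendsto_const_nhds hlim, ENNReal.tsum_comm]
  congr 1
  simp_rw [ENNReal.tsum_mul_right, hp, tsum_killedMass_eq_h0 hr hprob hν2 hharm, ht,
    ← ENNReal.tsum_mul_left]
  rw [ENNReal.tsum_comm]
  refine tsum_congr fun l => ?_
  rw [ENNReal.ofReal_mul' (hprob.1 l), ← tsum_ite_ofReal_h0 hharm.1, ← ENNReal.tsum_mul_right]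
  refine tsum_congr fun j => ?_
  split_ifs <;> simp [hp]

theorem h1_nonneg (hpos : ∀ l, 0 ≤ h0 r l) (l : ℤ) : 0 ≤ h1 r l := by
  rw [h1]
  split_ifs
  · exact Finset.sum_nonneg fun p _ => hpos p
  · exact le_rfl

theorem nuHarmonic_h1_iff (hr : r ∈ Set.Ioc (-1 : ℝ) 1) (hprob : IsProbDist ν)
    (hν2 : 0 < ν (-2)) (hharm : NuHarmonic ν (h0 r)) {x : ℝ≥0∞}
    (hx : Tendsto (fun n => (killedStep (fun l => ENNReal.ofReal (ν l)) (Set.Iio 0))^[n] 1 0)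
      atTop (𝓝 x)) :
    NuHarmonic ν (h1 r) ↔ x = 0 := by
  have hid := limit_add_tsum_h1 hr hprob hν2 hharm hx
  have h1one : h1 r 1 = 1 := by simp [h1, h0_zero]
  have hiff := tsum_ofReal_eq_iff_hasSum (f := fun l => h1 r (1 + l) * ν l) (a := 1)
    (fun l => mul_nonneg (h1_nonneg hharm.1 _) (hprob.1 l)) zero_le_one
  rw [ENNReal.ofReal_one] at hiff
  constructor
  · intro h
    have hs := h.2 1 le_rfl
    rw [h1one] at hs
    rw [hiff.mpr hs] at hid
    exact (ENNReal.add_left_inj ENNReal.one_ne_top).mp (hid.trans (zero_add 1).symm)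
  · rintro rfl
    rw [zero_add] at hid
    refine ⟨h1_nonneg hharm.1, fun k hk => ?_⟩
    induction k, hk using Int.leInduction with
    | base => rw [h1one]; exact hiff.mp hid
    | succ k hk ih =>
      rw [h1_add_one]
      refine (ih.add (hharm.2 k hk)).congr_fun fun l => ?_
      rw [add_right_comm, h1_add_one, add_mul]

end KilledWalk

section RandomWalk

open Filter Topology
open scoped ENNReal

variable {Ω : Type*} [MeasurableSpace Ω] {μ : Measure Ω}

open Classical in
theorem lintegral_walk_stay {Y : ℕ → Ω → ℤ} {p : ℤ → ℝ≥0∞} (hmeas : ∀ j, Measurable (Y j))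
    (hindep : iIndepFun Y μ) (hlaw : ∀ j k, μ (Y j ⁻¹' {k}) = p k) [IsProbabilityMeasure μ]
    (A : Set ℤ) (k : ℤ) (n : ℕ) (f : ℤ → ℝ≥0∞) :
    ∫⁻ ω, (if ∀ i < n, k + ∑ m ∈ Finset.range (i + 1), Y m ω ∈ A then
      f (k + ∑ m ∈ Finset.range n, Y m ω) else 0) ∂μ = (killedStep p A)^[n] f k := by
  induction n generalizing f with
  | zero => simp
  | succ n ih =>
    rw [Function.iterate_succ_apply, ← ih]
    let Z : Ω → (Finset.range n → ℤ) := fun ω i => Y i ω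
    let W : (Finset.range n → ℤ) → ℕ → ℤ := fun z m => if h : m ∈ Finset.range n then z ⟨m, h⟩ else 0
    have hW : ∀ ω i, i ≤ n → ∑ m ∈ Finset.range i, Y m ω = ∑ m ∈ Finset.range i, W (Z ω) m := by
      intro ω i hi
      refine Finset.sum_congr rfl fun m hm => ?_
      have : m ∈ Finset.range n := Finset.range_mono hi hm
      simp only [W, Z, dif_pos this]
    let F : ℤ → (Finset.range n → ℤ) → ℝ≥0∞ := fun l z =>
      if ∀ i < n, k + ∑ m ∈ Finset.range (i + 1), W z m ∈ A then
        A.indicator f (k + ∑ m ∈ Finset.range n, W z m + l) else 0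
    have hF : ∀ l ω, F l (Z ω) = if ∀ i < n, k + ∑ m ∈ Finset.range (i + 1), Y m ω ∈ A then
        A.indicator f (k + ∑ m ∈ Finset.range n, Y m ω + l) else 0 := by
      intro l ω
      have h : (∀ i < n, k + ∑ m ∈ Finset.range (i + 1), Y m ω ∈ A) ↔
          ∀ i < n, k + ∑ m ∈ Finset.range (i + 1), W (Z ω) m ∈ A :=
        forall₂_congr fun i hi => by rw [hW ω (i + 1) hi]
      simp only [F, h, hW ω n le_rfl]
    have hZ : Measurable Z := measurable_pi_lambda _ fun i => hmeas i
    have hFm : ∀ l, Measurable (fun ω => F l (Z ω)) := fun l =>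
      (measurable_of_countable (F l)).comp hZ
    have hind : ∀ l, Measurable (({l} : Set ℤ).indicator (1 : ℤ → ℝ≥0∞)) := fun l =>
      measurable_of_countable _
    have hZY : IndepFun Z (Y n) μ := by
      have h := hindep.indepFun_finset (Finset.range n) {n} (by simp) hmeas
      exact h.comp (φ := id) (ψ := fun z => z ⟨n, Finset.mem_singleton_self n⟩)
        measurable_id (measurable_of_countable _)
    have hstep : ∀ l, ∫⁻ ω, F l (Z ω) * ({l} : Set ℤ).indicator 1 (Y n ω) ∂μ =
        ∫⁻ ω, F l (Z ω) * p l ∂μ := by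
      intro l
      have h := lintegral_mul_eq_lintegral_mul_lintegral_of_indepFun (hFm l)
        ((hind l).comp (hmeas n)) (hZY.comp (measurable_of_countable (F l)) (hind l))
      have h2 : ∫⁻ ω, (({l} : Set ℤ).indicator (1 : ℤ → ℝ≥0∞) ∘ Y n) ω ∂μ = p l := by
        rw [← hlaw n l, ← lintegral_indicator_one (hmeas n (measurableSet_singleton l))]
        rfl
      rw [h2] at h
      rw [lintegral_mul_const _ (hFm l)]
      exact h
    calc _ = ∫⁻ ω, ∑' l, F l (Z ω) * ({l} : Set ℤ).indicator 1 (Y n ω) ∂μ := by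
          refine lintegral_congr fun ω => ?_
          rw [tsum_eq_single (Y n ω) (fun l hl => by simp [hl.symm]), hF,
            Set.indicator_of_mem (Set.mem_singleton _), Pi.one_apply, mul_one,
            Finset.sum_range_succ _ n, ← add_assoc]
          simp only [Nat.forall_lt_succ_right, Set.indicator_apply, Finset.sum_range_succ _ n,
            ← add_assoc]
          split_ifs <;> simp_all
      _ = ∫⁻ ω, ∑' l, F l (Z ω) * p l ∂μ := by
          rw [lintegral_tsum, lintegral_tsum]
          · exact tsum_congr hstep
          · exact fun l => ((hFm l).mul_const _).aemeasurable
          · exact fun l => ((hFm l).mul ((hind l).comp (hmeas n))).aemeasurable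
      _ = _ := by
          refine lintegral_congr fun ω => ?_
          simp only [hF, killedStep]
          split_ifs
          · simp only [mul_comm]
          · simp

section Walk

variable {Y : ℕ → Ω → ℤ} {p : ℤ → ℝ≥0∞} [IsProbabilityMeasure μ]

theorem measurableSet_walk_stay (hmeas : ∀ j, Measurable (Y j)) (A : Set ℤ) (k : ℤ) (n : ℕ) :
    MeasurableSet {ω | ∀ i < n, k + ∑ m ∈ Finset.range (i + 1), Y m ω ∈ A} := by
  have h : ∀ i, MeasurableSet {ω | k + ∑ m ∈ Finset.range (i + 1), Y m ω ∈ A} := fun i =>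
    ((Finset.measurable_sum _ fun m _ => hmeas m).const_add k) (.of_discrete (s := A))
  simp only [Set.ofPred_forall]
  exact .iInter fun i => .iInter fun _ => h i

theorem measure_walk_stay (hmeas : ∀ j, Measurable (Y j)) (hindep : iIndepFun Y μ)
    (hlaw : ∀ j k, μ (Y j ⁻¹' {k}) = p k) (A : Set ℤ) (k : ℤ) (n : ℕ) :
    μ {ω | ∀ i < n, k + ∑ m ∈ Finset.range (i + 1), Y m ω ∈ A} = (killedStep p A)^[n] 1 k := by
  classical
  rw [← lintegral_walk_stay hmeas hindep hlaw,
    ← lintegral_indicator_one (measurableSet_walk_stay hmeas A k n)]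
  refine lintegral_congr fun ω => ?_
  simp [Set.indicator_apply]

theorem tendsto_iterate_killedStep (hmeas : ∀ j, Measurable (Y j)) (hindep : iIndepFun Y μ)
    (hlaw : ∀ j k, μ (Y j ⁻¹' {k}) = p k) (A : Set ℤ) (k : ℤ) :
    Tendsto (fun n => (killedStep p A)^[n] 1 k) atTop
      (𝓝 (μ {ω | ∀ i, k + ∑ m ∈ Finset.range (i + 1), Y m ω ∈ A})) := by
  have h := tendsto_measure_iInter_atTop (μ := μ)
    (s := fun n => {ω | ∀ i < n, k + ∑ m ∈ Finset.range (i + 1), Y m ω ∈ A})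
    (fun n => (measurableSet_walk_stay hmeas A k n).nullMeasurableSet)
    (fun a b hab ω hω i hi => hω i (hi.trans_le hab)) ⟨0, measure_ne_top _ _⟩
  have hset : (⋂ n, {ω | ∀ i < n, k + ∑ m ∈ Finset.range (i + 1), Y m ω ∈ A}) =
      {ω | ∀ i, k + ∑ m ∈ Finset.range (i + 1), Y m ω ∈ A} := by
    ext ω
    simp only [Set.mem_iInter, Set.mem_ofPred_eq]
    exact ⟨fun h i => h (i + 1) i i.lt_succ_self, fun h n i _ => h i⟩
  rw [hset] at h
  exact h.congr fun n => measure_walk_stay hmeas hindep hlaw A k n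

/-- The probability that the walk started at `k` stays in `A` at all positive times is invariant
under the killed step. -/
theorem killedStep_measure_stay (hmeas : ∀ j, Measurable (Y j)) (hindep : iIndepFun Y μ)
    (hlaw : ∀ j k, μ (Y j ⁻¹' {k}) = p k) (hp : ∑' l, p l = 1) (A : Set ℤ) (k : ℤ) :
    killedStep p A (fun s => μ {ω | ∀ i, s + ∑ m ∈ Finset.range (i + 1), Y m ω ∈ A}) k =
      μ {ω | ∀ i, k + ∑ m ∈ Finset.range (i + 1), Y m ω ∈ A} := by
  have hlim := (tendsto_iterate_killedStep hmeas hindep hlaw A k).comp (tendsto_add_atTop_nat 1)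
  refine tendsto_nhds_unique ?_ hlim
  simp only [Function.comp_def, Function.iterate_succ_apply', killedStep, ← lintegral_count]
  refine tendsto_lintegral_of_dominated_convergence p (fun n => measurable_of_countable _)
    (fun n => ae_of_all _ fun l => ?_) (by rw [lintegral_count, hp]; exact ENNReal.one_ne_top)
    (ae_of_all _ fun l => ?_)
  · refine mul_le_of_le_one_right' (Set.indicator_apply_le' (fun _ => ?_) (fun _ => zero_le_one))
    rw [← measure_walk_stay hmeas hindep hlaw]
    exact prob_le_one
  · have hpl : p l ≠ ∞ := ne_top_of_le_ne_top ENNReal.one_ne_top (hp ▸ ENNReal.le_tsum l)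
    refine ENNReal.Tendsto.const_mul ?_ (Or.inr hpl)
    by_cases h : k + l ∈ A
    · simp only [Set.indicator_of_mem h]
      exact tendsto_iterate_killedStep hmeas hindep hlaw A (k + l)
    · simp only [Set.indicator_of_notMem h]
      exact tendsto_const_nhds

end Walk

variable [IsProbabilityMeasure μ] {r : ℝ} {ν : ℤ → ℝ} {Y : ℕ → Ω → ℤ}

theorem measure_walk_nonneg_eq_zero (hr : r ∈ Set.Ioc (-1 : ℝ) 1) (hprob : IsProbDist ν)
    (hν2 : 0 < ν (-2)) (hharm : NuHarmonic ν (h0 r)) (hmeas : ∀ j, Measurable (Y j))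
    (hindep : iIndepFun Y μ) (hlaw : ∀ j k, μ (Y j ⁻¹' {k}) = ENNReal.ofReal (ν k)) :
    μ {ω | ∀ i : ℕ, 0 ≤ ∑ m ∈ Finset.range i, Y m ω} = 0 := by
  set p : ℤ → ℝ≥0∞ := fun l => ENNReal.ofReal (ν l) with hp
  have hp1 : ∑' l, p l = 1 := by
    rw [(tsum_ofReal_eq_iff_hasSum hprob.1 zero_le_one).mpr hprob.2, ENNReal.ofReal_one]
  set q : ℤ → ℝ := (Set.Ici 1).indicator fun k =>
    μ.real {ω | ∀ i, k + ∑ m ∈ Finset.range (i + 1), Y m ω ∈ Set.Ici 1} with hq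
  have hq0 : ∀ k, 0 ≤ q k := fun k => Set.indicator_nonneg (fun _ _ => measureReal_nonneg) k
  have hqneg : ∀ k ≤ 0, q k = 0 := fun k hk => Set.indicator_of_notMem (by simp; omega) _
  have hq1 : ∀ k, q k ≤ 1 := fun k =>
    Set.indicator_apply_le' (fun _ => measureReal_le_one) (fun _ => zero_le_one)
  have hqmono : Monotone q := by
    intro a b hab
    rcases le_or_gt a 0 with ha | ha
    · rw [hqneg a ha]; exact hq0 b
    · rw [hq, Set.indicator_of_mem (show a ∈ Set.Ici 1 from ha),
        Set.indicator_of_mem (show b ∈ Set.Ici 1 from le_trans ha hab)]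
      refine measureReal_mono fun ω hω i => ?_
      have := Set.mem_Ici.mp (hω i)
      exact Set.mem_Ici.mpr (by linarith)
  have hqharm : ∀ k, 1 ≤ k → HasSum (fun l => q (k + l) * ν l) (q k) := by
    intro k hk
    rw [← tsum_ofReal_eq_iff_hasSum (fun l => mul_nonneg (hq0 _) (hprob.1 l)) (hq0 k)]
    conv_rhs => rw [hq, Set.indicator_of_mem (show k ∈ Set.Ici 1 from hk), ofReal_measureReal,
      ← killedStep_measure_stay hmeas hindep hlaw hp1]
    refine tsum_congr fun l => ?_
    rw [ENNReal.ofReal_mul (hq0 _), mul_comm]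
    congr 1
    by_cases h : k + l ∈ Set.Ici 1
    · rw [hq, Set.indicator_of_mem h, Set.indicator_of_mem h, ofReal_measureReal]
    · rw [hq, Set.indicator_of_notMem h, Set.indicator_of_notMem h, ENNReal.ofReal_zero]
  have hle : ∀ k, q 1 * h0 r k - (q (k + 1) - q k) ≤ 0 := by
    refine nonpos_of_harmonic hprob hν2 ?_ ?_ ?_
    · intro k hk
      rcases hk.lt_or_eq with h | rfl
      · rw [h0_of_neg r h, hqneg _ h, hqneg _ hk]; simp
      · simp [h0_zero, hqneg]
    · intro k hk
      refine ((hharm.2 k hk).mul_left (q 1)).sub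
        ((hqharm (k + 1) (by omega)).sub (hqharm k hk)) |>.congr_fun fun l => ?_
      rw [add_right_comm k 1 l]
      ring
    · have hbdd : BddAbove (Set.range q) := ⟨1, by rintro _ ⟨k, rfl⟩; exact hq1 k⟩
      have hlim := tendsto_atTop_ciSup hqmono hbdd
      have hshift : Tendsto (fun k : ℤ => k + 1) atTop atTop :=
        tendsto_atTop_add_const_right _ _ tendsto_id
      simpa using ((tendsto_h0 hr).const_mul (q 1)).sub ((hlim.comp hshift).sub hlim)
  have hq1zero : q 1 = 0 := by
    by_contra hne
    refine not_summable_h0 r hharm.1 ?_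
    rw [← summable_mul_left_iff hne]
    refine summable_of_sum_range_le (c := 1) (fun n => mul_nonneg (hq0 1) (hharm.1 n)) fun N => ?_
    calc ∑ n ∈ Finset.range N, q 1 * h0 r n
        ≤ ∑ n ∈ Finset.range N, (q ((n + 1 : ℕ) : ℤ) - q (n : ℕ)) :=
          Finset.sum_le_sum fun n _ => by
            have := hle n
            push_cast
            linarith
      _ = q (N : ℕ) - q ((0 : ℕ) : ℤ) := Finset.sum_range_sub (fun n : ℕ => q n) N
      _ ≤ 1 := by
          have := hq1 N
          have := hq0 ((0 : ℕ) : ℤ)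
          linarith
  rw [hq, Set.indicator_of_mem (Set.mem_Ici.mpr le_rfl), measureReal_eq_zero_iff] at hq1zero
  refine measure_mono_null ?_ hq1zero
  intro ω hω i
  exact Set.mem_Ici.mpr (by linarith [hω (i + 1)])

theorem measure_walk_neg_eq_zero_iff (hprob : IsProbDist ν)
    (hν2 : 0 < ν (-2)) (hmeas : ∀ j, Measurable (Y j))
    (hindep : iIndepFun Y μ) (hlaw : ∀ j k, μ (Y j ⁻¹' {k}) = ENNReal.ofReal (ν k)) :
    μ {ω | ∀ i, 0 + ∑ m ∈ Finset.range (i + 1), Y m ω ∈ Set.Iio 0} = 0 ↔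
      μ {ω | ∀ i : ℕ, ∑ m ∈ Finset.range i, Y m ω ≤ 0} = 0 := by
  constructor
  · intro h
    have hp1 : ∑' l, ENNReal.ofReal (ν l) = 1 := by
      rw [(tsum_ofReal_eq_iff_hasSum hprob.1 zero_le_one).mpr hprob.2, ENNReal.ofReal_one]
    rw [← killedStep_measure_stay hmeas hindep hlaw hp1, killedStep, ENNReal.tsum_eq_zero] at h
    have h2 := (mul_eq_zero.mp (h (-2))).resolve_left (ENNReal.ofReal_pos.mpr hν2).ne'
    rw [Set.indicator_of_mem (by simp)] at h2
    refine measure_mono_null ?_ h2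
    intro ω hω i
    exact Set.mem_Iio.mpr (by linarith [hω (i + 1)])
  · refine measure_mono_null fun ω hω i => ?_
    cases i with
    | zero => simp
    | succ i => exact (zero_add (∑ m ∈ Finset.range (i + 1), Y m ω) ▸ Set.mem_Iio.mp (hω i)).le

end RandomWalk

/-- the random walk oscillates if and only if `h_r^{(1)}` is
`ν`-harmonic on `ℤ_{>0}` (i.e. `ν` is critical). -/
theorem stmt6 {Ω : Type*} [MeasurableSpace Ω] (μ : Measure Ω) [IsProbabilityMeasure μ]
    (r : ℝ) (hr : r ∈ Set.Ioc (-1 : ℝ) 1)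
    (ν : ℤ → ℝ) (hprob : IsProbDist ν) (hν2 : 0 < ν (-2))
    (hharm : NuHarmonic ν (h0 r))
    (Y : ℕ → Ω → ℤ) (hmeas : ∀ j, Measurable (Y j))
    (hindep : iIndepFun Y μ)
    (hlaw : ∀ j k, μ (Y j ⁻¹' {k}) = ENNReal.ofReal (ν k)) :
    (μ {ω | ∀ i : ℕ, 0 ≤ ∑ m ∈ Finset.range i, Y m ω} = 0 ∧
     μ {ω | ∀ i : ℕ, ∑ m ∈ Finset.range i, Y m ω ≤ 0} = 0) ↔
    NuHarmonic ν (h1 r) := by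
  rw [nuHarmonic_h1_iff hr hprob hν2 hharm
      (tendsto_iterate_killedStep hmeas hindep hlaw (Set.Iio 0) 0),
    measure_walk_neg_eq_zero_iff hprob hν2 hmeas hindep hlaw,
    and_iff_right (measure_walk_nonneg_eq_zero hr hprob hν2 hharm hmeas hindep hlaw)]
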